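/- The normality zone of (f_0(T_n) − μ_n)/σ_n has size o((log n)^{1/6}): for every sequence (t_n) of nonnegative reals with t_n/(log n)^{1/6} → 0, one has lim_{n → ∞} (Σ_{k : k ≥ μ_n + t_n·σ_n} p_k^(n)) / (∫_{t_n}^∞ e^{−u²/2}/√(2π) du) = 1. -/

import Mathlib

open Finset

/-- `p n k` is the probability `p_k^{(n)} = P(f_0(T_n) = k)` that the random convex chain
`T_n` has exactly `k` vertices (besides the two corners), given by Buchta's formula:
`p_k^{(n)} = 2^k · Σ_{i_1+⋯+i_k = n, i_j ≥ 1} Π_{j=1}^{k} i_j / (s_j (s_j + 1))`,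
where `s_j = i_1 + ⋯ + i_j`.  In particular `p 0 0 = 1` and `p n 0 = 0` for `n ≥ 1`,
and `p n k = 0` for `k > n`. -/
noncomputable def p (n k : ℕ) : ℝ :=
  2 ^ k *
    ∑ i ∈ (Fintype.piFinset fun _ : Fin k => Finset.Icc 1 n).filter
        (fun i => ∑ j, i j = n),
      ∏ j : Fin k,
        (i j : ℝ) /
          (((∑ l ∈ Finset.univ.filter (fun l => l ≤ j), i l : ℕ) : ℝ) *
            (((∑ l ∈ Finset.univ.filter (fun l => l ≤ j), i l : ℕ) : ℝ) + 1))

/-- The mean `μ_n = E f_0(T_n) = Σ_{k=1}^n k p_k^{(n)}`. -/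
noncomputable def μ (n : ℕ) : ℝ := ∑ k ∈ Finset.Icc 1 n, (k : ℝ) * p n k

/-- The variance `σ_n² = Var f_0(T_n) = Σ_{k=1}^n (k − μ_n)² p_k^{(n)}`. -/
noncomputable def σsq (n : ℕ) : ℝ := ∑ k ∈ Finset.Icc 1 n, ((k : ℝ) - μ n) ^ 2 * p n k

/-- The upper-tail probability `P((f_0(T_n) − μ_n)/σ_n ≥ t) = Σ_{k ≥ μ_n + t σ_n} p_k^{(n)}`. -/
noncomputable def tailProb (n : ℕ) (t : ℝ) : ℝ :=
  ∑ k ∈ (Finset.Icc 1 n).filter (fun k : ℕ => μ n + t * Real.sqrt (σsq n) ≤ (k : ℝ)), p n k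

/-- Expectation of `f` under the law of a sum of independent Bernoulli variables whose success
probabilities are listed in `l`. -/
noncomputable def bernExp : List ℝ → (ℕ → ℝ) → ℝ
  | [], f => f 0
  | q :: l, f => (1 - q) * bernExp l f + q * bernExp l fun k => f (k + 1)

/-- The sum over the entries `q` of `l` of `q * (1 - q)` times the expectation of `f` under the law
of the Bernoulli sum with that entry left out. -/
noncomputable def bernBias : List ℝ → (ℕ → ℝ) → ℝ
  | [], _ => 0
  | q :: l, f => q * (1 - q) * bernExp l f +
      ((1 - q) * bernBias l f + q * bernBias l fun k => f (k + 1))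

/-- The variance of the Bernoulli sum. -/
noncomputable def bernVar (l : List ℝ) : ℝ := (l.map fun q => q * (1 - q)).sum

namespace bernExp

theorem add (l : List ℝ) (f g : ℕ → ℝ) :
    bernExp l (fun k => f k + g k) = bernExp l f + bernExp l g := by
  induction l generalizing f g with
  | nil => rfl
  | cons q l ih => simp only [bernExp, ih]; ring

theorem const_mul (l : List ℝ) (c : ℝ) (f : ℕ → ℝ) :
    bernExp l (fun k => c * f k) = c * bernExp l f := by
  induction l generalizing f with
  | nil => rfl
  | cons q l ih => simp only [bernExp, ih]; ring

theorem const (l : List ℝ) (c : ℝ) : bernExp l (fun _ => c) = c := by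
  induction l with
  | nil => rfl
  | cons q l ih => simp only [bernExp, ih]; ring

theorem sum {ι : Type*} (l : List ℝ) (s : Finset ι) (f : ι → ℕ → ℝ) :
    bernExp l (fun k => ∑ i ∈ s, f i k) = ∑ i ∈ s, bernExp l (f i) := by
  classical
  induction s using Finset.induction_on with
  | empty => simpa using const l 0
  | insert i s hi ih => simp only [Finset.sum_insert hi, add, ih]

theorem mono {l : List ℝ} (hl : ∀ q ∈ l, 0 ≤ q ∧ q ≤ 1) {f g : ℕ → ℝ} (h : ∀ k, f k ≤ g k) :
    bernExp l f ≤ bernExp l g := by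
  induction l generalizing f g with
  | nil => exact h 0
  | cons q l ih =>
    have hq := hl q (by simp)
    have hl' : ∀ q ∈ l, 0 ≤ q ∧ q ≤ 1 := fun r hr => hl r (by simp [hr])
    exact add_le_add (mul_le_mul_of_nonneg_left (ih hl' h) (by linarith))
      (mul_le_mul_of_nonneg_left (ih hl' fun k => h (k + 1)) hq.1)

end bernExp

namespace bernBias

theorem add (l : List ℝ) (f g : ℕ → ℝ) :
    bernBias l (fun k => f k + g k) = bernBias l f + bernBias l g := by
  induction l generalizing f g with
  | nil => simp [bernBias]
  | cons q l ih => simp only [bernBias, bernExp.add, ih]; ring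

theorem const_mul (l : List ℝ) (c : ℝ) (f : ℕ → ℝ) :
    bernBias l (fun k => c * f k) = c * bernBias l f := by
  induction l generalizing f with
  | nil => simp [bernBias]
  | cons q l ih =>
    simp only [bernBias, bernExp.const_mul, ih]; ring

theorem const (l : List ℝ) (c : ℝ) : bernBias l (fun _ => c) = bernVar l * c := by
  induction l with
  | nil => simp [bernBias, bernVar]
  | cons q l ih =>
    simp only [bernBias, bernExp.const, ih, bernVar, List.map_cons, List.sum_cons]; ring

theorem mono {l : List ℝ} (hl : ∀ q ∈ l, 0 ≤ q ∧ q ≤ 1) {f g : ℕ → ℝ} (h : ∀ k, f k ≤ g k) :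
    bernBias l f ≤ bernBias l g := by
  induction l generalizing f g with
  | nil => exact le_rfl
  | cons q l ih =>
    have hq := hl q (by simp)
    have hl' : ∀ q ∈ l, 0 ≤ q ∧ q ≤ 1 := fun r hr => hl r (by simp [hr])
    have hq1 : 0 ≤ 1 - q := by linarith
    exact add_le_add
      (mul_le_mul_of_nonneg_left (bernExp.mono hl' h) (mul_nonneg hq.1 hq1))
      (add_le_add (mul_le_mul_of_nonneg_left (ih hl' h) hq1)
        (mul_le_mul_of_nonneg_left (ih hl' fun k => h (k + 1)) hq.1))

/-- Stein's identity for Bernoulli sums. -/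
theorem bernExp_sub_mean_mul (l : List ℝ) (f : ℕ → ℝ) :
    bernExp l (fun k => ((k : ℝ) - l.sum) * f k) = bernBias l (fun k => f (k + 1) - f k) := by
  induction l generalizing f with
  | nil => simp [bernExp, bernBias]
  | cons q l ih =>
    have h1 : bernExp l (fun k => ((k : ℝ) - (q :: l).sum) * f k) =
        bernBias l (fun k => f (k + 1) - f k) - q * bernExp l f := by
      rw [← ih, sub_eq_add_neg, ← neg_mul, ← bernExp.const_mul, ← bernExp.add]
      congr 1; ext k; simp only [List.sum_cons]; ring
    have h2 : bernExp l (fun k => (((k + 1 : ℕ) : ℝ) - (q :: l).sum) * f (k + 1)) =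
        bernBias l (fun k => f (k + 1 + 1) - f (k + 1)) +
          (1 - q) * bernExp l (fun k => f (k + 1)) := by
      rw [← ih (fun k => f (k + 1)), ← bernExp.const_mul, ← bernExp.add]
      congr 1; ext k; simp only [List.sum_cons]; push_cast; ring
    have h3 : bernExp l (fun k => f (k + 1) - f k) =
        bernExp l (fun k => f (k + 1)) - bernExp l f := by
      rw [sub_eq_add_neg, ← neg_one_mul (bernExp l f), ← bernExp.const_mul, ← bernExp.add]
      congr 1; ext k; ring
    simp only [bernExp, bernBias, h1, h2, h3]
    ring

theorem le_var_mul_bernExp {l : List ℝ} (hl : ∀ q ∈ l, 0 ≤ q ∧ q ≤ 1) {g : ℕ → ℝ}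
    (hg : Monotone g) : bernBias l g ≤ bernVar l * bernExp l g := by
  induction l generalizing g with
  | nil => simp [bernBias, bernVar]
  | cons q l ih =>
    have hq := hl q (by simp)
    have hl' : ∀ q ∈ l, 0 ≤ q ∧ q ≤ 1 := fun r hr => hl r (by simp [hr])
    have hg' : Monotone fun k => g (k + 1) := fun a b h => hg (by omega)
    have h0 : bernExp l g ≤ bernExp l fun k => g (k + 1) :=
      bernExp.mono hl' fun k => hg (by omega)
    have h1 := mul_le_mul_of_nonneg_left (ih hl' hg) (show 0 ≤ 1 - q by linarith)
    have h2 := mul_le_mul_of_nonneg_left (ih hl' hg') hq.1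
    have h3 := mul_le_mul_of_nonneg_left h0
      (mul_nonneg (mul_nonneg hq.1 (show 0 ≤ 1 - q by linarith)) hq.1)
    simp only [bernBias, bernVar, bernExp, List.map_cons, List.sum_cons] at *
    nlinarith

theorem var_mul_bernExp_le {l : List ℝ} (hl : ∀ q ∈ l, 0 ≤ q ∧ q ≤ 1) {g : ℕ → ℝ}
    (hg : Monotone g) : bernVar l * bernExp l g ≤ bernBias l fun k => g (k + 1) := by
  induction l generalizing g with
  | nil => simp [bernBias, bernVar]
  | cons q l ih =>
    have hq := hl q (by simp)
    have hl' : ∀ q ∈ l, 0 ≤ q ∧ q ≤ 1 := fun r hr => hl r (by simp [hr])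
    have hg' : Monotone fun k => g (k + 1) := fun a b h => hg (by omega)
    have h0 : bernExp l g ≤ bernExp l fun k => g (k + 1) :=
      bernExp.mono hl' fun k => hg (by omega)
    have h1 := mul_le_mul_of_nonneg_left (ih hl' hg) (show 0 ≤ 1 - q by linarith)
    have h2 := mul_le_mul_of_nonneg_left (ih hl' hg') hq.1
    have h3 := mul_le_mul_of_nonneg_left h0
      (mul_nonneg (mul_nonneg hq.1 (show 0 ≤ 1 - q by linarith)) (show 0 ≤ 1 - q by linarith))
    simp only [bernBias, bernVar, bernExp, List.map_cons, List.sum_cons] at *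
    nlinarith

end bernBias

theorem bernExp_mean (l : List ℝ) : bernExp l (fun k => (k : ℝ)) = l.sum := by
  have h := bernBias.bernExp_sub_mean_mul l (fun _ => 1)
  simp only [mul_one, sub_self] at h
  rw [bernBias.const, mul_zero] at h
  have h2 := bernExp.add l (fun k => (k : ℝ) - l.sum) (fun _ => l.sum)
  simp only [sub_add_cancel] at h2
  rw [h2, h, bernExp.const, zero_add]

theorem bernExp_sq_sub_mean (l : List ℝ) :
    bernExp l (fun k => ((k : ℝ) - l.sum) ^ 2) = bernVar l := by
  have h := bernBias.bernExp_sub_mean_mul l (fun k => (k : ℝ) - l.sum)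
  have h1 : (fun k : ℕ => (((k + 1 : ℕ) : ℝ) - l.sum) - ((k : ℝ) - l.sum)) = fun _ => 1 := by
    ext k; push_cast; ring
  rw [h1, bernBias.const, mul_one] at h
  simpa only [sq] using h

theorem exp_le_cubic {x : ℝ} (hx : |x| ≤ 1) : Real.exp x ≤ 1 + x + x ^ 2 / 2 + |x| ^ 3 := by
  have h := Real.exp_bound hx (n := 3) (by norm_num)
  have h' := (abs_le.1 h).2
  norm_num [Finset.sum_range_succ, Nat.factorial] at h'
  have : 0 ≤ |x| ^ 3 := by positivity
  linarith

theorem bernoulli_mgf_le {q θ : ℝ} (hq : 0 ≤ q) (hq1 : q ≤ 1) (hθ : 0 ≤ θ) (hθ1 : θ ≤ 1) :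
    1 - q + q * Real.exp θ ≤ Real.exp (θ * q + q * (1 - q) * (θ ^ 2 / 2 + θ ^ 3)) := by
  have hr : 0 ≤ 1 - q := by linarith
  have h1 : |-(q * θ)| = q * θ := by rw [abs_neg, abs_of_nonneg (by positivity)]
  have h2 : |(1 - q) * θ| = (1 - q) * θ := abs_of_nonneg (by positivity)
  have e1 := exp_le_cubic (x := -(q * θ)) (by rw [h1]; nlinarith)
  have e2 := exp_le_cubic (x := (1 - q) * θ) (by rw [h2]; nlinarith)
  rw [h1] at e1
  rw [h2] at e2
  have e3 := Real.add_one_le_exp (q * (1 - q) * (θ ^ 2 / 2 + θ ^ 3))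
  have hcube : (1 - q) * (q * θ) ^ 3 + q * ((1 - q) * θ) ^ 3 ≤ q * (1 - q) * θ ^ 3 := by
    have : 0 ≤ q * (1 - q) * θ ^ 3 * (2 * (q * (1 - q))) := by positivity
    nlinarith
  have key : (1 - q) * Real.exp (-(q * θ)) + q * Real.exp ((1 - q) * θ) ≤
      Real.exp (q * (1 - q) * (θ ^ 2 / 2 + θ ^ 3)) := by
    nlinarith [mul_le_mul_of_nonneg_left e1 hr, mul_le_mul_of_nonneg_left e2 hq]
  calc 1 - q + q * Real.exp θ
      = Real.exp (θ * q) * ((1 - q) * Real.exp (-(q * θ)) + q * Real.exp ((1 - q) * θ)) := by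
        rw [mul_add, mul_left_comm, mul_left_comm (Real.exp (θ * q)) q, ← Real.exp_add,
          ← Real.exp_add, show θ * q + -(q * θ) = 0 by ring,
          show θ * q + (1 - q) * θ = θ by ring, Real.exp_zero, mul_one]
    _ ≤ _ := by
        rw [Real.exp_add]
        exact mul_le_mul_of_nonneg_left key (Real.exp_pos _).le

theorem bernExp_exp_le {l : List ℝ} (hl : ∀ q ∈ l, 0 ≤ q ∧ q ≤ 1) {θ : ℝ} (hθ : 0 ≤ θ)
    (hθ1 : θ ≤ 1) :
    bernExp l (fun k => Real.exp (θ * k)) ≤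
      Real.exp (θ * l.sum + bernVar l * (θ ^ 2 / 2 + θ ^ 3)) := by
  induction l with
  | nil => simp [bernExp, bernVar]
  | cons q l ih =>
    have hq := hl q (by simp)
    have h := ih fun r hr => hl r (by simp [hr])
    have hs : (fun k : ℕ => Real.exp (θ * ((k + 1 : ℕ) : ℝ))) =
        fun k : ℕ => Real.exp θ * Real.exp (θ * k) := by
      ext k; rw [← Real.exp_add]; push_cast; ring_nf
    calc bernExp (q :: l) (fun k => Real.exp (θ * k))
        = (1 - q + q * Real.exp θ) * bernExp l (fun k => Real.exp (θ * k)) := by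
          simp only [bernExp, hs, bernExp.const_mul]; ring
      _ ≤ Real.exp (θ * q + q * (1 - q) * (θ ^ 2 / 2 + θ ^ 3)) *
          Real.exp (θ * l.sum + bernVar l * (θ ^ 2 / 2 + θ ^ 3)) := by
          refine mul_le_mul (bernoulli_mgf_le hq.1 hq.2 hθ hθ1) h ?_ (Real.exp_pos _).le
          have := bernExp.mono (fun r hr => hl r (by simp [hr]) : ∀ r ∈ l, 0 ≤ r ∧ r ≤ 1)
            (f := fun _ => 0) (g := fun k => Real.exp (θ * k)) fun k => (Real.exp_pos _).le
          rwa [bernExp.const] at this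
      _ = _ := by
          rw [← Real.exp_add]
          simp only [bernVar, List.map_cons, List.sum_cons]; ring_nf

/-- Sub-Gaussian bound for the standardised Bernoulli sum in the range `s ^ 3 ≤ σ`. -/
theorem bernExp_exp_standardized_le {l : List ℝ} (hl : ∀ q ∈ l, 0 ≤ q ∧ q ≤ 1) {σ s : ℝ}
    (hσ : 1 ≤ σ) (hV : bernVar l = σ ^ 2) (hs : 0 ≤ s) (hs3 : s ^ 3 ≤ σ) :
    bernExp l (fun k => Real.exp (s * (((k : ℝ) - l.sum) / σ))) ≤ Real.exp (s ^ 2 / 2 + 1) := by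
  have hσ0 : 0 < σ := by linarith
  have hsσ : s ≤ σ := by
    rcases le_total s 1 with h | h
    · linarith
    · nlinarith [mul_nonneg hs (mul_nonneg hs (sub_nonneg.2 h)), mul_nonneg hs (sub_nonneg.2 h)]
  have hfun : (fun k : ℕ => Real.exp (s * (((k : ℝ) - l.sum) / σ))) =
      fun k : ℕ => Real.exp (-(s / σ * l.sum)) * Real.exp (s / σ * k) := by
    ext k; rw [← Real.exp_add]; congr 1; ring
  rw [hfun, bernExp.const_mul]
  calc _ ≤ Real.exp (-(s / σ * l.sum)) *
        Real.exp (s / σ * l.sum + bernVar l * ((s / σ) ^ 2 / 2 + (s / σ) ^ 3)) :=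
        mul_le_mul_of_nonneg_left
          (bernExp_exp_le hl (by positivity) ((div_le_one hσ0).2 hsσ)) (Real.exp_pos _).le
    _ = Real.exp (s ^ 2 / 2 + s ^ 3 / σ) := by
        rw [← Real.exp_add, hV]; congr 1; field_simp; ring
    _ ≤ _ := Real.exp_le_exp.2 (by linarith [(div_le_one hσ0).2 hs3])

open MeasureTheory in
/-- The upper tail of the standard normal distribution. -/
noncomputable def gaussTail (x : ℝ) : ℝ :=
  ∫ u in Set.Ioi x, Real.exp (-u ^ 2 / 2) / Real.sqrt (2 * Real.pi)

/-- The standard normal density. -/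
noncomputable def gaussDensity (x : ℝ) : ℝ := Real.exp (-x ^ 2 / 2) / Real.sqrt (2 * Real.pi)

theorem gaussDensity_pos (x : ℝ) : 0 < gaussDensity x := by unfold gaussDensity; positivity

theorem gaussDensity_neg (x : ℝ) : gaussDensity (-x) = gaussDensity x := by
  simp [gaussDensity]

theorem continuous_gaussDensity : Continuous gaussDensity := by unfold gaussDensity; fun_prop

theorem gaussDensity_eq (x : ℝ) :
    gaussDensity x = (Real.sqrt (2 * Real.pi))⁻¹ * Real.exp (-(1 / 2) * x ^ 2) := by
  rw [gaussDensity, div_eq_inv_mul]; ring_nf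

theorem integrable_gaussDensity : MeasureTheory.Integrable gaussDensity := by
  rw [funext gaussDensity_eq]
  exact (integrable_exp_neg_mul_sq (by norm_num)).const_mul _

theorem integral_gaussDensity : ∫ x, gaussDensity x = 1 := by
  rw [funext gaussDensity_eq, MeasureTheory.integral_const_mul, integral_gaussian,
    show Real.pi / (1 / 2) = 2 * Real.pi by ring]
  exact inv_mul_cancel₀ (by positivity)

theorem hasDerivAt_gaussDensity (x : ℝ) : HasDerivAt gaussDensity (-x * gaussDensity x) x := by
  have h : HasDerivAt (fun y : ℝ => -y ^ 2 / 2) (-x) x := by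
    convert! (((hasDerivAt_id x).pow 2).neg.div_const 2) using 1
    simp; ring
  convert! h.exp.div_const (Real.sqrt (2 * Real.pi)) using 1
  simp only [gaussDensity]; ring

theorem gaussTail_eq (x : ℝ) : gaussTail x = ∫ u in Set.Ioi x, gaussDensity u := rfl

theorem gaussTail_sub {x y : ℝ} : gaussTail x - gaussTail y = ∫ u in x..y, gaussDensity u := by
  rw [gaussTail_eq, gaussTail_eq, sub_eq_iff_eq_add]
  exact (intervalIntegral.integral_interval_add_Ioi integrable_gaussDensity.integrableOn
    integrable_gaussDensity.integrableOn).symm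

theorem gaussTail_neg (x : ℝ) : gaussTail (-x) = 1 - gaussTail x := by
  have h1 : gaussTail (-x) = ∫ u in Set.Iic x, gaussDensity u := by
    rw [gaussTail_eq, ← integral_comp_neg_Iic]
    simp only [gaussDensity_neg]
  have h2 := intervalIntegral.integral_Iic_add_Ioi (b := x)
    integrable_gaussDensity.integrableOn integrable_gaussDensity.integrableOn
  rw [integral_gaussDensity] at h2
  rw [h1, gaussTail_eq]; linarith

theorem gaussTail_pos (x : ℝ) : 0 < gaussTail x := by
  rw [gaussTail_eq, MeasureTheory.setIntegral_pos_iff_support_of_nonneg_ae]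
  · have : Function.support gaussDensity = Set.univ := by
      ext y; simp [(gaussDensity_pos y).ne']
    simp [this]
  · exact Filter.Eventually.of_forall fun y => (gaussDensity_pos y).le
  · exact integrable_gaussDensity.integrableOn

theorem gaussTail_lt_one (x : ℝ) : gaussTail x < 1 := by
  have := gaussTail_pos (-x)
  rw [gaussTail_neg] at this; linarith

theorem hasDerivAt_gaussTail (x : ℝ) : HasDerivAt gaussTail (-gaussDensity x) x := by
  have h : HasDerivAt (fun y => ∫ u in (0 : ℝ)..y, gaussDensity u) (gaussDensity x) x :=
    intervalIntegral.integral_hasDerivAt_right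
      (continuous_gaussDensity.intervalIntegrable _ _)
      continuous_gaussDensity.stronglyMeasurable.stronglyMeasurableAtFilter
      continuous_gaussDensity.continuousAt
  have h2 := h.const_sub (gaussTail 0)
  refine h2.congr_of_eventuallyEq (Filter.Eventually.of_forall fun y => ?_)
  simp only [← gaussTail_sub]; ring

theorem antitone_gaussTail : Antitone gaussTail :=
  antitone_of_deriv_nonpos (fun x => (hasDerivAt_gaussTail x).differentiableAt) fun x => by
    rw [(hasDerivAt_gaussTail x).deriv]; linarith [gaussDensity_pos x]

theorem tendsto_gaussTail : Filter.Tendsto gaussTail Filter.atTop (nhds 0) := by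
  have := MeasureTheory.tendsto_integral_Ioi_zero (f := gaussDensity)
    (μ := MeasureTheory.volume) (b := fun x : ℝ => x) (l := Filter.atTop) Filter.tendsto_id
  exact this

theorem tendsto_gaussDensity : Filter.Tendsto gaussDensity Filter.atTop (nhds 0) := by
  have h : Filter.Tendsto (fun x : ℝ => -x ^ 2 / 2) Filter.atTop Filter.atBot :=
    (Filter.tendsto_neg_atTop_atBot.comp (Filter.tendsto_pow_atTop two_ne_zero)).atBot_div_const
      two_pos
  have h2 := (Real.tendsto_exp_atBot.comp h).div_const (Real.sqrt (2 * Real.pi))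
  rw [zero_div] at h2
  exact h2

/-- Upper Mills ratio bound. -/
theorem mul_gaussTail_le (x : ℝ) : x * gaussTail x ≤ gaussDensity x := by
  rcases le_or_gt x 0 with hx | hx
  · exact (mul_nonpos_of_nonpos_of_nonneg hx (gaussTail_pos x).le).trans (gaussDensity_pos x).le
  have hd : ∀ y ∈ Set.Ioi (0 : ℝ), HasDerivAt (fun y => gaussTail y - gaussDensity y / y)
      (gaussDensity y / y ^ 2) y := by
    intro y hy
    have hy0 : y ≠ 0 := ne_of_gt hy
    convert! (hasDerivAt_gaussTail y).sub ((hasDerivAt_gaussDensity y).div (hasDerivAt_id y) hy0)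
      using 1
    simp only [id]
    field_simp
    ring
  have hmono : MonotoneOn (fun y => gaussTail y - gaussDensity y / y) (Set.Ioi 0) := by
    refine monotoneOn_of_deriv_nonneg (convex_Ioi 0)
      (fun y hy => (hd y hy).continuousAt.continuousWithinAt) ?_ ?_
    · rw [interior_Ioi]
      exact fun y hy => (hd y hy).differentiableAt.differentiableWithinAt
    · rw [interior_Ioi]
      intro y hy
      rw [(hd y hy).deriv]
      have := gaussDensity_pos y
      positivity
  have hlim : Filter.Tendsto (fun y => gaussTail y - gaussDensity y / y) Filter.atTop (nhds 0) := by
    simpa using tendsto_gaussTail.sub (tendsto_gaussDensity.div_atTop Filter.tendsto_id)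
  have h0 : gaussTail x - gaussDensity x / x ≤ 0 := by
    refine ge_of_tendsto hlim ?_
    filter_upwards [Filter.eventually_ge_atTop x] with y hy
    exact hmono hx (lt_of_lt_of_le hx hy) hy
  have h1 : gaussTail x ≤ gaussDensity x / x := by linarith
  rw [le_div_iff₀ hx] at h1
  linarith

/-- Lower Mills ratio bound. -/
theorem mul_gaussDensity_le (x : ℝ) : x * gaussDensity x ≤ (1 + x ^ 2) * gaussTail x := by
  have hd : ∀ y, HasDerivAt (fun y => gaussTail y - y / (1 + y ^ 2) * gaussDensity y)
      (-(2 * gaussDensity y / (1 + y ^ 2) ^ 2)) y := by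
    intro y
    have hy : 1 + y ^ 2 ≠ 0 := by positivity
    convert! (hasDerivAt_gaussTail y).sub (((hasDerivAt_id y).div
      (((hasDerivAt_id y).pow 2).const_add 1) hy).mul (hasDerivAt_gaussDensity y)) using 1
    simp only [id, Pi.pow_apply, Pi.div_apply]
    field_simp
    ring
  have hanti : Antitone fun y => gaussTail y - y / (1 + y ^ 2) * gaussDensity y := by
    refine antitone_of_deriv_nonpos (fun y => (hd y).differentiableAt) fun y => ?_
    rw [(hd y).deriv]
    have := gaussDensity_pos y
    exact neg_nonpos.2 (by positivity)
  have hlim : Filter.Tendsto (fun y => gaussTail y - y / (1 + y ^ 2) * gaussDensity y)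
      Filter.atTop (nhds 0) := by
    have h1 : Filter.Tendsto (fun y => y / (1 + y ^ 2) * gaussDensity y) Filter.atTop (nhds 0) := by
      refine squeeze_zero_norm (fun y => ?_) tendsto_gaussDensity
      rw [norm_mul, Real.norm_of_nonneg (gaussDensity_pos y).le]
      refine mul_le_of_le_one_left (gaussDensity_pos y).le ?_
      rw [Real.norm_eq_abs, abs_div, abs_of_pos (show 0 < 1 + y ^ 2 by positivity),
        div_le_one (by positivity)]
      nlinarith [sq_nonneg (|y| - 1), sq_abs y]
    simpa using tendsto_gaussTail.sub h1
  have h0 := hanti.le_of_tendsto hlim x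
  have hx : 0 < 1 + x ^ 2 := by positivity
  have h1 : x / (1 + x ^ 2) * gaussDensity x ≤ gaussTail x := by linarith
  rw [div_mul_eq_mul_div, div_le_iff₀ hx] at h1
  linarith

theorem gaussDensity_le_of_le {x s : ℝ} (hx : -1 ≤ x) (hs : x ≤ s) :
    gaussDensity s ≤ Real.exp (1 / 2) * gaussDensity x := by
  rw [gaussDensity, gaussDensity, ← mul_div_assoc, ← Real.exp_add]
  gcongr
  rcases le_total 0 x with h | h <;> nlinarith [sq_nonneg s]

theorem gaussDensity_le_gaussTail {z : ℝ} (hz : -1 ≤ z) :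
    gaussDensity z ≤ Real.exp (3 / 2) * (z + 2) * gaussTail z := by
  have ha : 0 < z + 2 := by linarith
  set b := z + 1 / (z + 2) with hb
  have hzb : z ≤ b := by rw [hb]; linarith [one_div_pos.2 ha]
  have h1 : ∫ u in z..b, Real.exp (-(3 / 2)) * gaussDensity z ≤ ∫ u in z..b, gaussDensity u := by
    refine intervalIntegral.integral_mono_on hzb (by simp)
      (continuous_gaussDensity.intervalIntegrable _ _) fun u hu => ?_
    rw [gaussDensity, gaussDensity, ← mul_div_assoc, ← Real.exp_add]
    gcongr
    set d := u - z with hd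
    have hu' : u = z + d := by ring
    have hd0 : 0 ≤ d := by linarith [hu.1]
    have hd1 : d * (z + 2) ≤ 1 := by
      rw [← le_div_iff₀ ha]; linarith [hu.2]
    rw [hu']
    nlinarith
  rw [intervalIntegral.integral_const, ← gaussTail_sub, smul_eq_mul,
    show b - z = 1 / (z + 2) by rw [hb]; ring] at h1
  have h2 : 1 / (z + 2) * (Real.exp (-(3 / 2)) * gaussDensity z) ≤ gaussTail z := by
    linarith [gaussTail_pos b]
  rw [one_div, inv_mul_le_iff₀ ha] at h2
  calc gaussDensity z = Real.exp (3 / 2) * (Real.exp (-(3 / 2)) * gaussDensity z) := by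
        rw [← mul_assoc, ← Real.exp_add]; simp
    _ ≤ Real.exp (3 / 2) * ((z + 2) * gaussTail z) :=
        mul_le_mul_of_nonneg_left h2 (Real.exp_pos _).le
    _ = _ := by ring

/-- The Gaussian tail varies slowly at scale `1 / (x + 2)`. -/
theorem gaussTail_sub_le {x y : ℝ} (hx : -1 ≤ x) (hxy : x ≤ y) :
    gaussTail x - gaussTail y ≤ Real.exp 2 * (x + 2) * (y - x) * gaussTail x := by
  have h1 : ∫ u in x..y, gaussDensity u ≤ ∫ u in x..y, Real.exp (1 / 2) * gaussDensity x :=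
    intervalIntegral.integral_mono_on hxy (continuous_gaussDensity.intervalIntegrable _ _)
      (by simp) fun u hu => gaussDensity_le_of_le hx hu.1
  rw [intervalIntegral.integral_const, ← gaussTail_sub, smul_eq_mul] at h1
  calc _ ≤ (y - x) * (Real.exp (1 / 2) * gaussDensity x) := h1
    _ ≤ (y - x) * (Real.exp (1 / 2) * (Real.exp (3 / 2) * (x + 2) * gaussTail x)) := by
        have := gaussDensity_le_gaussTail hx
        have := sub_nonneg.2 hxy
        gcongr
    _ = _ := by
        rw [show (2 : ℝ) = 1 / 2 + 3 / 2 by norm_num, Real.exp_add]; norm_num; ring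

/-- The Mills ratio of the standard normal distribution. -/
noncomputable def millsRatio (x : ℝ) : ℝ := gaussTail x / gaussDensity x

theorem millsRatio_pos (x : ℝ) : 0 < millsRatio x := div_pos (gaussTail_pos x) (gaussDensity_pos x)

theorem mul_millsRatio_le (x : ℝ) : x * millsRatio x ≤ 1 := by
  rw [millsRatio, ← mul_div_assoc, div_le_one (gaussDensity_pos x)]
  exact mul_gaussTail_le x

theorem hasDerivAt_millsRatio (x : ℝ) : HasDerivAt millsRatio (x * millsRatio x - 1) x := by
  have h0 := (gaussDensity_pos x).ne'
  convert! (hasDerivAt_gaussTail x).div (hasDerivAt_gaussDensity x) h0 using 1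
  rw [millsRatio]; field_simp; ring

theorem monotone_mul_millsRatio : Monotone fun x => x * millsRatio x := by
  have hd : ∀ x, HasDerivAt (fun x => x * millsRatio x)
      (1 * millsRatio x + x * (x * millsRatio x - 1)) x := fun x =>
    (hasDerivAt_id x).mul (hasDerivAt_millsRatio x)
  refine monotone_of_deriv_nonneg (fun x => (hd x).differentiableAt) fun x => ?_
  rw [(hd x).deriv]
  have h := mul_gaussDensity_le x
  have h2 : x ≤ (1 + x ^ 2) * millsRatio x := by
    rw [millsRatio, ← mul_div_assoc, le_div_iff₀ (gaussDensity_pos x)]; exact h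
  linarith

/-- The (negated) bounded solution of Stein's equation for the half-line `(z, ∞)`. -/
noncomputable def steinSol (z w : ℝ) : ℝ :=
  if w ≤ z then millsRatio (-w) * gaussTail z else millsRatio w * (1 - gaussTail z)

theorem steinSol_of_le {z w : ℝ} (h : w ≤ z) : steinSol z w = millsRatio (-w) * gaussTail z :=
  if_pos h

theorem steinSol_of_ge {z w : ℝ} (h : z ≤ w) :
    steinSol z w = millsRatio w * (1 - gaussTail z) := by
  rcases h.eq_or_lt with rfl | h
  · rw [steinSol_of_le le_rfl, millsRatio, millsRatio, gaussDensity_neg, gaussTail_neg]; ring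
  · exact if_neg h.not_ge

theorem monotone_mul_steinSol (z : ℝ) : Monotone fun w => w * steinSol z w := by
  have hl : ∀ a b, a ≤ b → b ≤ z → a * steinSol z a ≤ b * steinSol z b := by
    intro a b hab hb
    rw [steinSol_of_le hb, steinSol_of_le (hab.trans hb)]
    have h := mul_le_mul_of_nonneg_right (monotone_mul_millsRatio (neg_le_neg hab))
      (gaussTail_pos z).le
    simp only at h
    linarith
  have hr : ∀ a b, a ≤ b → z ≤ a → a * steinSol z a ≤ b * steinSol z b := by
    intro a b hab ha
    rw [steinSol_of_ge ha, steinSol_of_ge (ha.trans hab)]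
    have h := mul_le_mul_of_nonneg_right (monotone_mul_millsRatio hab)
      (sub_nonneg.2 (gaussTail_lt_one z).le)
    simp only at h
    linarith
  intro a b hab
  rcases le_total b z with hb | hb
  · exact hl a b hab hb
  rcases le_total a z with ha | ha
  · exact (hl a z ha le_rfl).trans (hr z b hb le_rfl)
  · exact hr a b hab ha

theorem steinSol_sub_of_le {z a b : ℝ} (hab : a < b) (hb : b ≤ z) :
    (b - a) * (a * steinSol z a + gaussTail z) ≤ steinSol z b - steinSol z a ∧
      steinSol z b - steinSol z a ≤ (b - a) * (b * steinSol z b + gaussTail z) := by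
  have hd : ∀ x, HasDerivAt (fun w => millsRatio (-w) * gaussTail z)
      (x * (millsRatio (-x) * gaussTail z) + gaussTail z) x := by
    intro x
    convert! ((hasDerivAt_millsRatio (-x)).comp x (hasDerivAt_neg x)).mul_const (gaussTail z)
      using 1
    ring
  obtain ⟨c, hc, hs⟩ := exists_hasDerivAt_eq_slope (fun w => millsRatio (-w) * gaussTail z) _ hab
    (fun x _ => (hd x).continuousAt.continuousWithinAt) fun x _ => hd x
  have hba : 0 < b - a := sub_pos.2 hab
  rw [eq_div_iff hba.ne', ← steinSol_of_le hb, ← steinSol_of_le (hab.le.trans hb),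
    ← steinSol_of_le (hc.2.le.trans hb)] at hs
  have h1 := monotone_mul_steinSol z hc.1.le
  have h2 := monotone_mul_steinSol z hc.2.le
  simp only at h1 h2
  rw [← hs]
  constructor <;> nlinarith

theorem steinSol_sub_of_ge {z a b : ℝ} (hab : a < b) (ha : z ≤ a) :
    (b - a) * (a * steinSol z a + gaussTail z - 1) ≤ steinSol z b - steinSol z a ∧
      steinSol z b - steinSol z a ≤ (b - a) * (b * steinSol z b + gaussTail z - 1) := by
  have hd : ∀ x, HasDerivAt (fun w => millsRatio w * (1 - gaussTail z))
      (x * (millsRatio x * (1 - gaussTail z)) + gaussTail z - 1) x := by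
    intro x
    convert! (hasDerivAt_millsRatio x).mul_const (1 - gaussTail z) using 1
    ring
  obtain ⟨c, hc, hs⟩ := exists_hasDerivAt_eq_slope (fun w => millsRatio w * (1 - gaussTail z)) _
    hab (fun x _ => (hd x).continuousAt.continuousWithinAt) fun x _ => hd x
  have hba : 0 < b - a := sub_pos.2 hab
  rw [eq_div_iff hba.ne', ← steinSol_of_ge ha, ← steinSol_of_ge (ha.trans hab.le),
    ← steinSol_of_ge (ha.trans hc.1.le)] at hs
  have h1 := monotone_mul_steinSol z hc.1.le
  have h2 := monotone_mul_steinSol z hc.2.le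
  simp only at h1 h2
  rw [← hs]
  constructor <;> nlinarith

/-- Pointwise bound on the Stein remainder by quantities with controlled expectations. -/
theorem sq_mul_steinSol_le {z w : ℝ} (hz : -1 ≤ z) :
    w ^ 2 * steinSol z w ≤ gaussTail z * (1 + w ^ 2) +
      gaussTail z * ∑ j ∈ range ⌊z + 2⌋₊, (z + 2) ^ 2 * (Real.sqrt (2 * Real.pi) *
        Real.exp (1 / 2 - (j : ℝ) ^ 2 / 2)) * Real.exp (j * w) +
      (z + 2) * Real.exp (-(z + 2) * z) * Real.exp ((z + 2) * w) := by
  have hQ := gaussTail_pos z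
  have ha : 1 ≤ z + 2 := by linarith
  have hA : 0 ≤ gaussTail z * (1 + w ^ 2) := by positivity
  have hterm : ∀ j ∈ range ⌊z + 2⌋₊, 0 ≤ (z + 2) ^ 2 * (Real.sqrt (2 * Real.pi) *
        Real.exp (1 / 2 - (j : ℝ) ^ 2 / 2)) * Real.exp (j * w) := fun j _ => by positivity
  have hB : 0 ≤ gaussTail z * ∑ j ∈ range ⌊z + 2⌋₊, (z + 2) ^ 2 * (Real.sqrt (2 * Real.pi) *
        Real.exp (1 / 2 - (j : ℝ) ^ 2 / 2)) * Real.exp (j * w) :=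
    mul_nonneg hQ.le (sum_nonneg hterm)
  have hC : 0 ≤ (z + 2) * Real.exp (-(z + 2) * z) * Real.exp ((z + 2) * w) := by positivity
  rcases le_or_gt w 0 with hw | hw
  · have h1 : steinSol z w ≤ millsRatio (-w) * gaussTail z := by
      rcases le_total w z with h | h
      · exact (steinSol_of_le h).le
      · rw [steinSol_of_ge h, millsRatio, millsRatio, gaussDensity_neg, gaussTail_neg,
          div_mul_eq_mul_div, div_mul_eq_mul_div]
        have := antitone_gaussTail h
        have h0 := gaussDensity_pos w
        gcongr ?_ / _
        nlinarith
    have h2 := mul_millsRatio_le (-w)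
    have h3 : w ^ 2 * millsRatio (-w) ≤ 1 + w ^ 2 := by nlinarith
    have h4 : w ^ 2 * steinSol z w ≤ gaussTail z * (1 + w ^ 2) := by
      calc _ ≤ w ^ 2 * (millsRatio (-w) * gaussTail z) := by gcongr
        _ = gaussTail z * (w ^ 2 * millsRatio (-w)) := by ring
        _ ≤ _ := by gcongr
    linarith
  rcases le_or_gt w z with hwz | hwz
  · have hj : ⌊w⌋₊ ∈ range ⌊z + 2⌋₊ := by
      rw [mem_range, ← Nat.add_one_le_iff]
      refine Nat.le_floor ?_
      push_cast
      linarith [Nat.floor_le hw.le]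
    have h1 := single_le_sum hterm hj
    have hf1 := Nat.floor_le hw.le
    have hf2 := Nat.lt_floor_add_one w
    have h2 : w ^ 2 * millsRatio (-w) ≤ (z + 2) ^ 2 * (Real.sqrt (2 * Real.pi) *
        Real.exp (1 / 2 - (⌊w⌋₊ : ℝ) ^ 2 / 2)) * Real.exp (⌊w⌋₊ * w) := by
      have h3 : millsRatio (-w) ≤ Real.sqrt (2 * Real.pi) * Real.exp (w ^ 2 / 2) := by
        rw [millsRatio, gaussDensity_neg, div_le_iff₀ (gaussDensity_pos w), gaussDensity,
          mul_assoc, mul_div_assoc', ← Real.exp_add,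
          show w ^ 2 / 2 + -w ^ 2 / 2 = 0 by ring, Real.exp_zero,
          mul_one_div_cancel (by positivity)]
        exact (gaussTail_lt_one _).le
      have h4 : Real.exp (w ^ 2 / 2) ≤
          Real.exp (1 / 2 - (⌊w⌋₊ : ℝ) ^ 2 / 2) * Real.exp (⌊w⌋₊ * w) := by
        rw [← Real.exp_add]
        exact Real.exp_le_exp.2 (by nlinarith)
      calc _ ≤ (z + 2) ^ 2 * (Real.sqrt (2 * Real.pi) *
            (Real.exp (1 / 2 - (⌊w⌋₊ : ℝ) ^ 2 / 2) * Real.exp (⌊w⌋₊ * w))) := by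
            have := (millsRatio_pos (-w)).le
            have := h3.trans (mul_le_mul_of_nonneg_left h4 (Real.sqrt_nonneg _))
            gcongr
            linarith
        _ = _ := by ring
    have h3 := mul_le_mul_of_nonneg_left (h2.trans h1) hQ.le
    rw [steinSol_of_le hwz]
    linarith
  · have h1 : steinSol z w ≤ millsRatio w := by
      rw [steinSol_of_ge hwz.le]
      exact mul_le_of_le_one_right (millsRatio_pos w).le (by linarith)
    have h2 : w ^ 2 * steinSol z w ≤ w := by
      have := mul_millsRatio_le w
      calc _ ≤ w ^ 2 * millsRatio w := by gcongr
        _ = w * (w * millsRatio w) := by ring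
        _ ≤ _ := mul_le_of_le_one_right hw.le this
    have h3 : w ≤ (z + 2) * Real.exp (-(z + 2) * z) * Real.exp ((z + 2) * w) := by
      rw [mul_assoc, ← Real.exp_add]
      have h4 := Real.add_one_le_exp (-(z + 2) * z + (z + 2) * w)
      have h5 : 0 ≤ (z + 2) * (w - z) - (w - z) := by nlinarith
      calc w ≤ (z + 2) * (1 + (z + 2) * (w - z)) := by nlinarith
        _ ≤ _ := by gcongr; linarith
    linarith

/-- Constant in the moderate deviation estimate for Bernoulli sums. -/
noncomputable def modDevConst : ℝ :=
  2 + Real.sqrt (2 * Real.pi) * Real.exp (3 / 2) + Real.sqrt (2 * Real.pi) * Real.exp (9 / 2)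

theorem bernExp_stein_remainder_le {l : List ℝ} (hl : ∀ q ∈ l, 0 ≤ q ∧ q ≤ 1) {σ z : ℝ}
    (hσ : 1 ≤ σ) (hV : bernVar l = σ ^ 2) (hz : -1 ≤ z) (hz3 : (z + 2) ^ 3 ≤ σ) :
    bernExp l (fun k => (((k : ℝ) - l.sum) / σ) ^ 2 * steinSol z (((k : ℝ) - l.sum) / σ)) ≤
      modDevConst * (z + 2) ^ 3 * gaussTail z := by
  have hσ0 : 0 < σ := by linarith
  have hQ := gaussTail_pos z
  have ha : 1 ≤ z + 2 := by linarith
  refine (bernExp.mono hl fun k => sq_mul_steinSol_le (w := ((k : ℝ) - l.sum) / σ) hz).trans ?_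
  simp only [bernExp.add, bernExp.const_mul, bernExp.const, bernExp.sum]
  have h1 : bernExp l (fun k => (((k : ℝ) - l.sum) / σ) ^ 2) = 1 := by
    have : (fun k : ℕ => (((k : ℝ) - l.sum) / σ) ^ 2) =
        fun k : ℕ => (σ ^ 2)⁻¹ * ((k : ℝ) - l.sum) ^ 2 := by
      ext k; rw [div_pow, div_eq_inv_mul]
    rw [this, bernExp.const_mul, bernExp_sq_sub_mean, hV]
    exact inv_mul_cancel₀ (by positivity)
  have h2 : ∑ j ∈ range ⌊z + 2⌋₊, (z + 2) ^ 2 * (Real.sqrt (2 * Real.pi) *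
        Real.exp (1 / 2 - (j : ℝ) ^ 2 / 2)) *
        bernExp l (fun k => Real.exp (j * (((k : ℝ) - l.sum) / σ))) ≤
      Real.sqrt (2 * Real.pi) * Real.exp (3 / 2) * (z + 2) ^ 3 := by
    have hj : ∀ j ∈ range ⌊z + 2⌋₊, (z + 2) ^ 2 * (Real.sqrt (2 * Real.pi) *
        Real.exp (1 / 2 - (j : ℝ) ^ 2 / 2)) *
        bernExp l (fun k => Real.exp (j * (((k : ℝ) - l.sum) / σ))) ≤
        (z + 2) ^ 2 * (Real.sqrt (2 * Real.pi) * Real.exp (3 / 2)) := by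
      intro j hj
      have hja : (j : ℝ) ≤ z + 2 :=
        (Nat.cast_le.2 (mem_range.1 hj).le).trans (Nat.floor_le (by linarith))
      have hj3 : (j : ℝ) ^ 3 ≤ σ := (pow_le_pow_left₀ (by positivity) hja 3).trans hz3
      have h := bernExp_exp_standardized_le hl hσ hV (Nat.cast_nonneg j) hj3
      calc _ ≤ (z + 2) ^ 2 * (Real.sqrt (2 * Real.pi) *
            Real.exp (1 / 2 - (j : ℝ) ^ 2 / 2)) * Real.exp ((j : ℝ) ^ 2 / 2 + 1) := by gcongr
        _ = (z + 2) ^ 2 * (Real.sqrt (2 * Real.pi) *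
            (Real.exp (1 / 2 - (j : ℝ) ^ 2 / 2) * Real.exp ((j : ℝ) ^ 2 / 2 + 1))) := by ring
        _ = _ := by rw [← Real.exp_add]; ring_nf
    refine (sum_le_card_nsmul _ _ _ hj).trans ?_
    rw [card_range, nsmul_eq_mul]
    calc _ ≤ (z + 2) * ((z + 2) ^ 2 * (Real.sqrt (2 * Real.pi) * Real.exp (3 / 2))) := by
          gcongr; exact Nat.floor_le (by linarith)
      _ = _ := by ring
  have h3 : (z + 2) * Real.exp (-(z + 2) * z) *
        bernExp l (fun k => Real.exp ((z + 2) * (((k : ℝ) - l.sum) / σ))) ≤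
      Real.sqrt (2 * Real.pi) * Real.exp (9 / 2) * (z + 2) ^ 3 * gaussTail z := by
    have h := bernExp_exp_standardized_le hl hσ hV (by linarith : 0 ≤ z + 2) hz3
    have hφ : Real.exp (-z ^ 2 / 2) = Real.sqrt (2 * Real.pi) * gaussDensity z := by
      rw [gaussDensity]; field_simp
    calc _ ≤ (z + 2) * Real.exp (-(z + 2) * z) * Real.exp ((z + 2) ^ 2 / 2 + 1) := by gcongr
      _ = (z + 2) * (Real.exp 3 * Real.exp (-z ^ 2 / 2)) := by
          rw [mul_assoc, ← Real.exp_add, ← Real.exp_add]; ring_nf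
      _ ≤ (z + 2) * (Real.exp 3 * (Real.sqrt (2 * Real.pi) *
            (Real.exp (3 / 2) * (z + 2) * gaussTail z))) := by
          rw [hφ]
          have := gaussDensity_le_gaussTail hz
          gcongr
      _ = Real.sqrt (2 * Real.pi) * (Real.exp 3 * Real.exp (3 / 2)) * (z + 2) ^ 2 *
            gaussTail z := by ring
      _ = Real.sqrt (2 * Real.pi) * Real.exp (9 / 2) * (z + 2) ^ 2 * gaussTail z := by
          rw [← Real.exp_add]; norm_num
      _ ≤ _ := by gcongr; norm_num
  have h4 : 1 ≤ (z + 2) ^ 3 := one_le_pow₀ ha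
  rw [h1, modDevConst]
  nlinarith [mul_le_mul_of_nonneg_left h2 hQ.le, mul_le_mul_of_nonneg_left h4 hQ.le]

/-- Stein's method for the size-biased tail of a Bernoulli sum. -/
theorem abs_bernBias_tail_sub_le {l : List ℝ} (hl : ∀ q ∈ l, 0 ≤ q ∧ q ≤ 1) {σ : ℝ}
    (hσ : 1 ≤ σ) (hV : bernVar l = σ ^ 2) {m : ℕ} {z : ℝ} (hm : z = ((m : ℝ) - l.sum) / σ)
    (hz : -1 ≤ z) (hz3 : (z + 2) ^ 3 ≤ σ) :
    |bernBias l (fun k => if m ≤ k then 1 else 0) - σ ^ 2 * gaussTail z| ≤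
      σ ^ 2 * (modDevConst * (z + 2) ^ 3 / σ * gaussTail z) := by
  have hσ0 : 0 < σ := by linarith
  set w : ℕ → ℝ := fun k => ((k : ℝ) - l.sum) / σ with hw
  have hstep : ∀ k, w (k + 1) - w k = 1 / σ := by
    intro k; simp only [hw]; push_cast; ring
  have hwlt : ∀ k, w k < w (k + 1) := fun k => by
    have := hstep k
    have := one_div_pos.2 hσ0
    linarith
  have hwm : Monotone w := monotone_nat_of_le_succ fun k => (hwlt k).le
  have hzm : w m = z := hm.symm
  set F : ℕ → ℝ := fun k => steinSol z (w k) with hF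
  set G : ℕ → ℝ := fun k => w k * F k with hG
  have hGm : Monotone G := (monotone_mul_steinSol z).comp hwm
  set I : ℕ → ℝ := fun k => if m ≤ k then 1 else 0 with hI
  have hpt : ∀ k, G k ≤ σ * (F (k + 1) - F k) + (-gaussTail z + I k) ∧
      σ * (F (k + 1) - F k) + (-gaussTail z + I k) ≤ G (k + 1) := by
    intro k
    by_cases hk : m ≤ k
    · have h := steinSol_sub_of_ge (hwlt k) (hzm ▸ hwm hk)
      rw [hstep, one_div_mul_eq_div, one_div_mul_eq_div, div_le_iff₀ hσ0, le_div_iff₀ hσ0] at h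
      simp only [hI, hG, hF, if_pos hk]
      constructor <;> linarith [h.1, h.2]
    · have h := steinSol_sub_of_le (hwlt k) (hzm ▸ hwm (show k + 1 ≤ m by omega))
      rw [hstep, one_div_mul_eq_div, one_div_mul_eq_div, div_le_iff₀ hσ0, le_div_iff₀ hσ0] at h
      simp only [hI, hG, hF, if_neg hk]
      constructor <;> linarith [h.1, h.2]
  have hmul : ∀ f : ℕ → ℝ, bernBias l (fun k => f (k + 1) - f k) =
      σ * bernExp l (fun k => w k * f k) := by
    intro f
    rw [← bernBias.bernExp_sub_mean_mul, ← bernExp.const_mul]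
    congr 1; ext k; simp only [hw]; field_simp
  have hlo := bernBias.mono hl fun k => (hpt k).1
  have hhi := bernBias.mono hl fun k => (hpt k).2
  simp only [bernBias.add, bernBias.const_mul, bernBias.const, hV] at hlo hhi
  rw [hmul F] at hlo hhi
  have hlo' := bernBias.le_var_mul_bernExp hl hGm
  have hhi' := bernBias.var_mul_bernExp_le hl hGm
  rw [hV] at hlo' hhi'
  have hdiff := hmul G
  have hsub : bernBias l (fun k => G (k + 1) - G k) =
      bernBias l (fun k => G (k + 1)) - bernBias l G := by
    have := bernBias.add l (fun k => G (k + 1) - G k) G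
    simp only [sub_add_cancel] at this
    linarith
  have hrem := bernExp_stein_remainder_le hl hσ hV hz hz3
  have hrem' : bernExp l (fun k => w k * G k) ≤ modDevConst * (z + 2) ^ 3 * gaussTail z := by
    refine le_of_eq_of_le ?_ hrem
    congr 1; ext k; simp only [hG, hF, hw]; ring
  have hfin : σ ^ 2 * (modDevConst * (z + 2) ^ 3 / σ * gaussTail z) =
      σ * (modDevConst * (z + 2) ^ 3 * gaussTail z) := by field_simp
  rw [hfin]
  have := mul_le_mul_of_nonneg_left hrem' hσ0.le
  rw [abs_le]
  constructor <;> nlinarith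

theorem bernVar_le_sum {l : List ℝ} (hl : ∀ q ∈ l, 0 ≤ q ∧ q ≤ 1) : bernVar l ≤ l.sum := by
  have h : (l.map fun q => q * (1 - q)).sum ≤ (l.map id).sum :=
    List.sum_le_sum fun q hq => by
      have := hl q hq
      simp only [id]
      nlinarith [this.1, this.2]
  simpa [bernVar] using h

/-- Moderate deviation estimate for Bernoulli sums. -/
theorem bernExp_tail_estimate {l : List ℝ} (hl : ∀ q ∈ l, 0 ≤ q ∧ q ≤ 1) {σ t δ : ℝ}
    (hV : bernVar l = σ ^ 2) (ht : 0 ≤ t) (ht3 : (t + 4) ^ 3 ≤ σ)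
    (hδ : (modDevConst + Real.exp 2) * (t + 4) ^ 3 / σ = δ) (hδ1 : δ ≤ 1) :
    (1 - δ) ^ 2 * gaussTail t ≤
        bernExp l (fun k => if l.sum + t * σ ≤ (k : ℝ) then 1 else 0) ∧
      (1 - δ) * bernExp l (fun k => if l.sum + t * σ ≤ (k : ℝ) then 1 else 0) ≤
        (1 + δ) * gaussTail t := by
  have hσ : 1 ≤ σ := le_trans (one_le_pow₀ (by linarith)) ht3
  have hσ0 : 0 < σ := by linarith
  have hC : 0 ≤ modDevConst := by unfold modDevConst; positivity
  have hδa : ∀ a, 0 ≤ a → a ≤ t + 4 → modDevConst * a ^ 3 / σ ≤ δ := by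
    intro a ha ha'
    rw [← hδ]
    gcongr
    exact le_add_of_nonneg_right (Real.exp_pos 2).le
  have hδb : ∀ a, 0 ≤ a → a ≤ t + 4 → Real.exp 2 * a * (1 / σ) ≤ δ := by
    intro a ha ha'
    rw [← hδ, mul_one_div]
    have h1 : a ≤ (t + 4) ^ 3 := by nlinarith [mul_nonneg ht ht, mul_nonneg (mul_nonneg ht ht) ht]
    gcongr
    exact le_add_of_nonneg_left hC
  have hpos : 0 < l.sum + t * σ := by
    have := bernVar_le_sum hl
    rw [hV] at this
    have := mul_nonneg ht hσ0.le
    nlinarith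
  obtain ⟨m, hm⟩ : ∃ m, ⌈l.sum + t * σ⌉₊ = m + 1 :=
    Nat.exists_eq_succ_of_ne_zero (Nat.ceil_pos.2 hpos).ne'
  have hI : (fun k : ℕ => if l.sum + t * σ ≤ (k : ℝ) then (1 : ℝ) else 0) =
      fun k => if m + 1 ≤ k then 1 else 0 := by
    ext k; rw [← hm]; simp only [Nat.ceil_le]
  have hIm : Monotone fun k : ℕ => if m + 1 ≤ k then (1 : ℝ) else 0 := by
    intro a b hab
    simp only
    split_ifs <;> first | omega | norm_num
  have hlo := bernBias.le_var_mul_bernExp hl hIm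
  have hhi := bernBias.var_mul_bernExp_le hl hIm
  simp only [add_le_add_iff_right] at hhi
  rw [hV] at hlo hhi
  have hm1 : l.sum + t * σ ≤ m + 1 := by
    have := Nat.le_ceil (l.sum + t * σ)
    rw [hm] at this; exact_mod_cast this
  have hm2 : (m : ℝ) < l.sum + t * σ := Nat.lt_ceil.1 (by omega)
  rw [hI]
  set T := bernExp l (fun k => if m + 1 ≤ k then 1 else 0)
  set z₁ := (((m + 1 : ℕ) : ℝ) - l.sum) / σ with hz₁
  set z₀ := ((m : ℝ) - l.sum) / σ with hz₀
  have hzz : z₁ = z₀ + 1 / σ := by rw [hz₁, hz₀]; push_cast; ring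
  have hz₁t : t ≤ z₁ := by
    rw [hz₁, le_div_iff₀ hσ0]; push_cast; linarith
  have hz₀t : z₀ ≤ t := by
    rw [hz₀, div_le_iff₀ hσ0]; linarith
  have hσ1 : 1 / σ ≤ 1 := (div_le_one hσ0).2 hσ
  have hp : ∀ a, 0 ≤ a → a ≤ t + 4 → a ^ 3 ≤ σ := fun a ha ha' =>
    (pow_le_pow_left₀ ha ha' 3).trans ht3
  have e₁ := abs_bernBias_tail_sub_le hl hσ hV hz₁ (by linarith)
    (hp _ (by linarith) (by linarith))
  have e₀ := abs_bernBias_tail_sub_le hl hσ hV hz₀ (by linarith)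
    (hp _ (by linarith) (by linarith))
  have hQ₁ := gaussTail_pos z₁
  have hQ₀ := gaussTail_pos z₀
  have hQt := gaussTail_pos t
  have d₁ := mul_le_mul_of_nonneg_right
    (hδa (z₁ + 2) (by linarith) (by linarith)) hQ₁.le
  have d₀ := mul_le_mul_of_nonneg_right
    (hδa (z₀ + 2) (by linarith) (by linarith)) hQ₀.le
  have hσ2 : 0 < σ ^ 2 := by positivity
  have f₁ : (1 - δ) * gaussTail z₁ ≤ T := by
    refine le_of_mul_le_mul_left ?_ hσ2
    nlinarith [(abs_le.1 e₁).1, mul_le_mul_of_nonneg_left d₁ hσ2.le]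
  have f₀ : T ≤ (1 + δ) * gaussTail z₀ := by
    refine le_of_mul_le_mul_left ?_ hσ2
    nlinarith [(abs_le.1 e₀).2, mul_le_mul_of_nonneg_left d₀ hσ2.le]
  have g₁ : gaussTail t - gaussTail z₁ ≤ δ * gaussTail t := by
    refine (gaussTail_sub_le (by linarith) hz₁t).trans ?_
    gcongr
    refine le_trans ?_ (hδb (t + 2) (by linarith) (by linarith))
    gcongr
    linarith
  have g₀ : gaussTail z₀ - gaussTail t ≤ δ * gaussTail z₀ := by
    refine (gaussTail_sub_le (by linarith) hz₀t).trans ?_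
    gcongr
    refine le_trans ?_ (hδb (z₀ + 2) (by linarith) (by linarith))
    exact mul_le_mul_of_nonneg_left (by linarith)
      (mul_nonneg (Real.exp_pos 2).le (by linarith))
  have hδ0 : 0 ≤ δ := by rw [← hδ]; positivity
  constructor
  · nlinarith [mul_le_mul_of_nonneg_left g₁ (sub_nonneg.2 hδ1)]
  · nlinarith [mul_le_mul_of_nonneg_left g₀ (by linarith : 0 ≤ 1 + δ),
      mul_le_mul_of_nonneg_left f₀ (sub_nonneg.2 hδ1)]

theorem sum_filter_le_snoc_castSucc {k : ℕ} (i : Fin k → ℕ) (a : ℕ) (j : Fin k) :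
    ∑ l ∈ univ.filter (fun l => l ≤ j.castSucc), (Fin.snoc i a : Fin (k + 1) → ℕ) l =
      ∑ l ∈ univ.filter (fun l => l ≤ j), i l := by
  rw [sum_filter, sum_filter, Fin.sum_univ_castSucc]
  simp [Fin.castSucc_lt_last, not_le.2]

theorem sum_filter_le_snoc_last {k : ℕ} (i : Fin k → ℕ) (a : ℕ) :
    ∑ l ∈ univ.filter (fun l => l ≤ Fin.last k), (Fin.snoc i a : Fin (k + 1) → ℕ) l =
      ∑ l, i l + a := by
  rw [sum_filter, Fin.sum_univ_castSucc]
  simp [Fin.le_last]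

theorem p_succ (n k : ℕ) :
    (n : ℝ) * (n + 1) * p n (k + 1) = 2 * ∑ m ∈ range n, ((n : ℝ) - m) * p m k := by
  have key : ∑ i ∈ (Fintype.piFinset fun _ : Fin (k + 1) => Finset.Icc 1 n).filter
        (fun i => ∑ j, i j = n),
      ∏ j : Fin (k + 1),
        (i j : ℝ) /
          (((∑ l ∈ Finset.univ.filter (fun l => l ≤ j), i l : ℕ) : ℝ) *
            (((∑ l ∈ Finset.univ.filter (fun l => l ≤ j), i l : ℕ) : ℝ) + 1)) =
      ∑ m ∈ range n, ∑ i ∈ (Fintype.piFinset fun _ : Fin k => Finset.Icc 1 m).filter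
        (fun i => ∑ j, i j = m), (∏ j : Fin k,
        (i j : ℝ) /
          (((∑ l ∈ Finset.univ.filter (fun l => l ≤ j), i l : ℕ) : ℝ) *
            (((∑ l ∈ Finset.univ.filter (fun l => l ≤ j), i l : ℕ) : ℝ) + 1))) *
        (((n : ℝ) - m) / (n * (n + 1))) := by
    rw [sum_sigma']
    refine (sum_bij' (fun (x : (_ : ℕ) × (Fin k → ℕ)) _ => (Fin.snoc x.2 (n - x.1) : Fin (k + 1) → ℕ))
      (fun i _ => ⟨∑ j : Fin k, i j.castSucc, Fin.init i⟩) ?_ ?_ ?_ ?_ ?_).symm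
    · rintro ⟨m, i⟩ h
      simp only [mem_sigma, mem_range, mem_filter, Fintype.mem_piFinset, mem_Icc] at h ⊢
      obtain ⟨hm, hi, hs⟩ := h
      refine ⟨fun j => ?_, ?_⟩
      · refine Fin.lastCases ?_ (fun j => ?_) j
        · rw [Fin.snoc_last]; omega
        · rw [Fin.snoc_castSucc]; have := hi j; omega
      · rw [Fin.sum_univ_castSucc]
        simp only [Fin.snoc_castSucc, Fin.snoc_last, hs]; omega
    · intro i h
      simp only [mem_sigma, mem_range, mem_filter, Fintype.mem_piFinset, mem_Icc] at h ⊢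
      obtain ⟨hi, hs⟩ := h
      rw [Fin.sum_univ_castSucc] at hs
      refine ⟨by have := hi (Fin.last k); omega, fun j => ⟨(hi j.castSucc).1, ?_⟩, rfl⟩
      exact single_le_sum (f := fun j : Fin k => i j.castSucc) (fun _ _ => Nat.zero_le _)
        (mem_univ j)
    · rintro ⟨m, i⟩ h
      simp only [mem_sigma, mem_range, mem_filter, Fintype.mem_piFinset, mem_Icc] at h
      simp [Fin.init_snoc, h.2.2]
    · intro i h
      simp only [mem_filter, Fintype.mem_piFinset, mem_Icc] at h
      obtain ⟨hi, hs⟩ := h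
      rw [Fin.sum_univ_castSucc] at hs
      have : n - ∑ j : Fin k, i j.castSucc = i (Fin.last k) := by omega
      simp only [this, Fin.snoc_init_self]
    · rintro ⟨m, i⟩ h
      simp only [mem_sigma, mem_range, mem_filter, Fintype.mem_piFinset, mem_Icc] at h
      obtain ⟨hm, hi, hs⟩ := h
      rw [Fin.prod_univ_castSucc]
      simp only [sum_filter_le_snoc_castSucc, sum_filter_le_snoc_last, Fin.snoc_castSucc,
        Fin.snoc_last, hs]
      rw [Nat.cast_sub hm.le, Nat.add_sub_cancel' hm.le]
  rcases Nat.eq_zero_or_pos n with rfl | hn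
  · simp
  have hn' : (n : ℝ) ≠ 0 := by positivity
  rw [p, key, pow_succ, mul_sum, mul_sum, mul_sum]
  refine sum_congr rfl fun m _ => ?_
  rw [p, ← sum_mul]
  field_simp

theorem p_zero_zero : p 0 0 = 1 := by simp [p]

theorem p_pos_zero {n : ℕ} (hn : 0 < n) : p n 0 = 0 := by
  simp [p, hn.ne]

theorem p_nonneg (n k : ℕ) : 0 ≤ p n k := by unfold p; positivity

theorem p_eq_zero_of_lt {n k : ℕ} (h : n < k) : p n k = 0 := by
  induction k generalizing n with
  | zero => omega
  | succ k ih =>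
    rcases Nat.eq_zero_or_pos n with rfl | hn
    · simp [p, Fintype.piFinset_empty]
    have h1 := p_succ n k
    rw [sum_eq_zero fun m hm => by rw [ih (by have := mem_range.1 hm; omega), mul_zero],
      mul_zero] at h1
    have : (n : ℝ) * (n + 1) ≠ 0 := by positivity
    exact (mul_eq_zero.1 h1).resolve_left this

theorem p_one_one : p 1 1 = 1 := by
  have h := p_succ 1 0
  simp [p_zero_zero] at h
  linarith

theorem p_three_term (n k : ℕ) :
    ((n : ℝ) + 2) * (n + 3) * p (n + 2) (k + 1) - 2 * (n + 1) * (n + 2) * p (n + 1) (k + 1) +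
      n * (n + 1) * p n (k + 1) = 2 * p (n + 1) k := by
  have h0 := p_succ n k
  have h1 := p_succ (n + 1) k
  have h2 := p_succ (n + 2) k
  rw [sum_range_succ] at h1
  rw [sum_range_succ, sum_range_succ] at h2
  push_cast at h1 h2
  have e1 : ∑ m ∈ range n, ((n : ℝ) + 1 - m) * p m k =
      ∑ m ∈ range n, ((n : ℝ) - m) * p m k + ∑ m ∈ range n, p m k := by
    rw [← sum_add_distrib]; exact sum_congr rfl fun m _ => by ring
  have e2 : ∑ m ∈ range n, ((n : ℝ) + 2 - m) * p m k =
      ∑ m ∈ range n, ((n : ℝ) - m) * p m k + 2 * ∑ m ∈ range n, p m k := by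
    rw [mul_sum, ← sum_add_distrib]; exact sum_congr rfl fun m _ => by ring
  rw [e1] at h1
  rw [e2] at h2
  linear_combination h2 - 2 * h1 + h0

section GeneratingPolynomial

open Polynomial

/-- The generating polynomial `∑ k, p n k * X ^ k`. -/
noncomputable def genPoly (n : ℕ) : ℝ[X] := ∑ k ∈ range (n + 1), monomial k (p n k)

theorem coeff_genPoly (n k : ℕ) : (genPoly n).coeff k = p n k := by
  simp only [genPoly, finsetSum_coeff, coeff_monomial, sum_ite_eq', mem_range]
  split_ifs with h
  · rfl
  · exact (p_eq_zero_of_lt (by omega)).symm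

theorem genPoly_zero : genPoly 0 = 1 := by simp [genPoly, p_zero_zero]

theorem genPoly_one : genPoly 1 = X := by
  simp [genPoly, sum_range_succ, p_pos_zero, p_one_one, X]

theorem genPoly_three_term (n : ℕ) :
    C (((n : ℝ) + 2) * (n + 3)) * genPoly (n + 2) - C (2 * ((n : ℝ) + 1) * (n + 2)) * genPoly (n + 1) +
      C ((n : ℝ) * (n + 1)) * genPoly n = C 2 * (X * genPoly (n + 1)) := by
  ext k
  cases k with
  | zero =>
    simp only [coeff_add, coeff_sub, coeff_C_mul, coeff_genPoly, coeff_X_mul_zero,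
      p_pos_zero (Nat.succ_pos _)]
    rcases Nat.eq_zero_or_pos n with rfl | hn
    · simp
    · simp [p_pos_zero hn]
  | succ k =>
    simp only [coeff_add, coeff_sub, coeff_C_mul, coeff_genPoly, coeff_X_mul]
    exact p_three_term n k

/-- The linear functional `X ^ k ↦ f k` on polynomials. -/
noncomputable def momentMap (f : ℕ → ℝ) : ℝ[X] →ₗ[ℝ] ℝ :=
  lsum fun k => f k • LinearMap.id

theorem momentMap_monomial (f : ℕ → ℝ) (k : ℕ) (a : ℝ) : momentMap f (monomial k a) = f k * a := by
  simp [momentMap, lsum_apply, sum_monomial_index]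

theorem momentMap_C_mul (f : ℕ → ℝ) (a : ℝ) (P : ℝ[X]) :
    momentMap f (C a * P) = a * momentMap f P := by
  rw [← smul_eq_C_mul, map_smul, smul_eq_mul]

theorem momentMap_X_mul (f : ℕ → ℝ) (P : ℝ[X]) :
    momentMap f (X * P) = momentMap (fun k => f (k + 1)) P := by
  induction P using Polynomial.induction_on' with
  | add P Q hP hQ => rw [mul_add, map_add, map_add, hP, hQ]
  | monomial k a => rw [X_mul_monomial, momentMap_monomial, momentMap_monomial]

theorem momentMap_one (f : ℕ → ℝ) : momentMap f 1 = f 0 := by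
  rw [← monomial_zero_one, momentMap_monomial, mul_one]

theorem momentMap_X (f : ℕ → ℝ) : momentMap f X = f 1 := by
  rw [X, momentMap_monomial, mul_one]

theorem momentMap_add (f g : ℕ → ℝ) (P : ℝ[X]) :
    momentMap (fun k => f k + g k) P = momentMap f P + momentMap g P := by
  induction P using Polynomial.induction_on' with
  | add P Q hP hQ => simp only [map_add, hP, hQ]; ring
  | monomial k a => simp only [momentMap_monomial]; ring

theorem momentMap_const_mul (c : ℝ) (f : ℕ → ℝ) (P : ℝ[X]) :
    momentMap (fun k => c * f k) P = c * momentMap f P := by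
  induction P using Polynomial.induction_on' with
  | add P Q hP hQ => simp only [map_add, hP, hQ]; ring
  | monomial k a => simp only [momentMap_monomial]; ring

theorem momentMap_genPoly (f : ℕ → ℝ) {n : ℕ} (hn : 0 < n) :
    momentMap f (genPoly n) = ∑ k ∈ Finset.Icc 1 n, f k * p n k := by
  rw [genPoly, map_sum, sum_congr rfl fun k _ => momentMap_monomial f k _,
    sum_range_succ', p_pos_zero hn, mul_zero, add_zero, range_eq_Ico,
    sum_Ico_add' (fun k => f k * p n k)]
  rfl

theorem momentMap_three_term (f : ℕ → ℝ) (n : ℕ) :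
    ((n : ℝ) + 2) * (n + 3) * momentMap f (genPoly (n + 2)) -
      2 * ((n : ℝ) + 1) * (n + 2) * momentMap f (genPoly (n + 1)) +
      (n : ℝ) * (n + 1) * momentMap f (genPoly n) =
        2 * momentMap (fun k => f (k + 1)) (genPoly (n + 1)) := by
  have h := congrArg (momentMap f) (genPoly_three_term n)
  simpa only [map_add, map_sub, momentMap_C_mul, momentMap_X_mul] using h

theorem momentMap_one_genPoly (n : ℕ) : momentMap (fun _ => 1) (genPoly n) = 1 := by
  induction n using Nat.twoStepInduction with
  | zero => rw [genPoly_zero, momentMap_one]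
  | one => rw [genPoly_one, momentMap_X]
  | more n h0 h1 =>
    have h := momentMap_three_term (fun _ => 1) n
    simp only [h0, h1] at h
    have : ((n : ℝ) + 2) * (n + 3) ≠ 0 := by positivity
    apply mul_left_cancel₀ this
    linear_combination h

theorem momentMap_eq_eval (x : ℝ) (P : ℝ[X]) : momentMap (fun k => x ^ k) P = P.eval x := by
  induction P using Polynomial.induction_on' with
  | add P Q hP hQ => rw [map_add, hP, hQ, eval_add]
  | monomial k a => rw [momentMap_monomial, eval_monomial, mul_comm]

theorem eval_one_genPoly (n : ℕ) : (genPoly n).eval 1 = 1 := by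
  rw [← momentMap_eq_eval]
  simpa using momentMap_one_genPoly n

/-- The mean of the distribution with generating polynomial `genPoly n`. -/
noncomputable def meanOf (n : ℕ) : ℝ := momentMap (fun k => (k : ℝ)) (genPoly n)

/-- The second factorial moment of the distribution with generating polynomial `genPoly n`. -/
noncomputable def factMomentOf (n : ℕ) : ℝ := momentMap (fun k => (k : ℝ) * (k - 1)) (genPoly n)

theorem meanOf_step (n : ℕ) : meanOf (n + 2) - meanOf (n + 1) = 2 / (3 * ((n : ℝ) + 2)) := by
  have hrec : ∀ n : ℕ, ((n : ℝ) + 2) * (n + 3) * meanOf (n + 2) -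
      2 * ((n : ℝ) + 1) * (n + 2) * meanOf (n + 1) + (n : ℝ) * (n + 1) * meanOf n =
        2 * (meanOf (n + 1) + 1) := by
    intro n
    have h := momentMap_three_term (fun k => (k : ℝ)) n
    simp only [Nat.cast_add, Nat.cast_one, momentMap_add, momentMap_one_genPoly] at h
    exact h
  induction n with
  | zero =>
    have h := hrec 0
    have h1 : meanOf 1 = 1 := by simp [meanOf, genPoly_one, momentMap_X]
    norm_num [h1] at h ⊢
    linarith
  | succ n ih =>
    have h := hrec (n + 1)
    push_cast at h ⊢
    have h3 : ((n : ℝ) + 3) ≠ 0 := by positivity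
    have h2 : ((n : ℝ) + 2) ≠ 0 := by positivity
    have h4 : ((n : ℝ) + 4) ≠ 0 := by positivity
    rw [eq_div_iff (by positivity)] at ih ⊢
    apply mul_left_cancel₀ h4
    linear_combination 3 * h + (n + 1) * ih

theorem factMomentOf_step (n : ℕ) : factMomentOf (n + 2) - factMomentOf (n + 1) =
    4 * meanOf (n + 2) / (3 * ((n : ℝ) + 2)) -
      4 / 27 * (2 * n + 9) / (((n : ℝ) + 2) * (n + 3)) := by
  have hrec : ∀ n : ℕ, ((n : ℝ) + 2) * (n + 3) * factMomentOf (n + 2) -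
      2 * ((n : ℝ) + 1) * (n + 2) * factMomentOf (n + 1) + (n : ℝ) * (n + 1) * factMomentOf n =
        2 * (factMomentOf (n + 1) + 2 * meanOf (n + 1)) := by
    intro n
    have h := momentMap_three_term (fun k => (k : ℝ) * (k - 1)) n
    have hs : (fun k : ℕ => ((k + 1 : ℕ) : ℝ) * (((k + 1 : ℕ) : ℝ) - 1)) =
        fun k : ℕ => (k : ℝ) * (k - 1) + 2 * k := by
      ext k; push_cast; ring
    simp only [hs, momentMap_add, momentMap_const_mul] at h
    exact h
  induction n with
  | zero =>
    have h := hrec 0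
    have h1 : meanOf 1 = 1 := by simp [meanOf, genPoly_one, momentMap_X]
    have h2 := meanOf_step 0
    have h3 : factMomentOf 1 = 0 := by simp [factMomentOf, genPoly_one, momentMap_X]
    norm_num [h1, h3] at h h2 ⊢
    linarith
  | succ n ih =>
    have h := hrec (n + 1)
    have hm := meanOf_step (n + 1)
    push_cast at h hm ⊢
    have h3 : ((n : ℝ) + 3) ≠ 0 := by positivity
    have h2 : ((n : ℝ) + 2) ≠ 0 := by positivity
    have h4 : ((n : ℝ) + 4) ≠ 0 := by positivity
    have e3 : meanOf (n + 1 + 2) = meanOf (n + 2) + 2 / (3 * ((n : ℝ) + 1 + 2)) := by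
      linarith
    have e : factMomentOf (n + 1 + 2) - factMomentOf (n + 1 + 1) =
        (((n : ℝ) + 1) * (n + 2) * (factMomentOf (n + 2) - factMomentOf (n + 1)) +
          4 * meanOf (n + 2)) / ((n + 3) * (n + 4)) := by
      rw [eq_div_iff (by positivity)]
      linear_combination h
    rw [e, ih, e3]
    have h5 : ((n : ℝ) + 1 + 2) ≠ 0 := by positivity
    have h6 : ((n : ℝ) + 1 + 3) ≠ 0 := by positivity
    field_simp
    ring

theorem log_le_factMomentOf (n : ℕ) :
    10 / 27 * (Real.log (n + 2) - 1) ≤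
      factMomentOf (n + 1) + meanOf (n + 1) - meanOf (n + 1) ^ 2 := by
  induction n with
  | zero =>
    have h1 : meanOf 1 = 1 := by simp [meanOf, genPoly_one, momentMap_X]
    have h3 : factMomentOf 1 = 0 := by simp [factMomentOf, genPoly_one, momentMap_X]
    have h := Real.log_le_sub_one_of_pos (show (0 : ℝ) < 2 by norm_num)
    norm_num [h1, h3] at h ⊢
    linarith
  | succ n ih =>
    have hm := meanOf_step n
    have hf := factMomentOf_step n
    have hlog : Real.log ((n : ℝ) + 1 + 2) - Real.log (n + 2) ≤ 1 / (n + 2) := by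
      rw [← Real.log_div (by positivity) (by positivity)]
      refine (Real.log_le_sub_one_of_pos (by positivity)).trans (le_of_eq ?_)
      field_simp; ring
    have hV : factMomentOf (n + 2) + meanOf (n + 2) - meanOf (n + 2) ^ 2 -
        (factMomentOf (n + 1) + meanOf (n + 1) - meanOf (n + 1) ^ 2) =
        10 / 27 * (1 / (n + 2)) + 4 / (9 * ((n : ℝ) + 2) ^ 2 * (n + 3)) := by
      have e1 : meanOf (n + 1) = meanOf (n + 2) - 2 / (3 * ((n : ℝ) + 2)) := by linarith
      have e2 : factMomentOf (n + 1) = factMomentOf (n + 2) -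
          (4 * meanOf (n + 2) / (3 * ((n : ℝ) + 2)) -
            4 / 27 * (2 * n + 9) / (((n : ℝ) + 2) * (n + 3))) := by linarith
      rw [e1, e2]
      field_simp
      ring
    have : 0 ≤ 4 / (9 * ((n : ℝ) + 2) ^ 2 * (n + 3)) := by positivity
    push_cast
    simp only [add_assoc, Nat.reduceAdd] at *
    linarith

/-- The complex zeros of the generating polynomials are real. -/
theorem eval_genPoly_ne_zero {z : ℂ} (hz : 0 < z.im) (n : ℕ) :
    aeval z (genPoly n) ≠ 0 ∧
      0 < (aeval z (genPoly (n + 1)) * starRingEnd ℂ (aeval z (genPoly n))).im := by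
  induction n with
  | zero => simp [genPoly_zero, genPoly_one, hz]
  | succ n ih =>
    obtain ⟨-, h⟩ := ih
    have hne : aeval z (genPoly (n + 1)) ≠ 0 := by
      intro h0
      rw [h0, zero_mul] at h
      exact lt_irrefl _ h
    refine ⟨hne, ?_⟩
    have hrec := congrArg (aeval z) (genPoly_three_term n)
    simp only [map_add, map_sub, map_mul, aeval_C, aeval_X, Complex.coe_algebraMap] at hrec
    rw [add_assoc, one_add_one_eq_two]
    set a := aeval z (genPoly (n + 2))
    set b := aeval z (genPoly (n + 1))
    set c := aeval z (genPoly n)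
    have hre := congrArg Complex.re hrec
    have him := congrArg Complex.im hrec
    simp only [Complex.add_re, Complex.add_im, Complex.sub_re, Complex.sub_im, Complex.mul_re,
      Complex.mul_im, Complex.conj_re, Complex.conj_im, Complex.ofReal_re, Complex.ofReal_im,
      zero_mul, sub_zero, add_zero] at hre him h ⊢
    have hb : 0 < b.re ^ 2 + b.im ^ 2 := by
      have := Complex.normSq_pos.2 hne
      rw [Complex.normSq_apply] at this
      linarith
    have hN : 0 < ((n : ℝ) + 2) * (n + 3) := by positivity
    refine pos_of_mul_pos_right (a := ((n : ℝ) + 2) * (n + 3)) ?_ hN.le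
    have e : ((n : ℝ) + 2) * (n + 3) * (a.re * -b.im + a.im * b.re) =
        2 * z.im * (b.re ^ 2 + b.im ^ 2) +
          (n : ℝ) * (n + 1) * (b.re * -c.im + b.im * c.re) := by
      linear_combination b.re * him - b.im * hre
    rw [e]
    have : 0 ≤ (n : ℝ) * (n + 1) * (b.re * -c.im + b.im * c.re) :=
      mul_nonneg (by positivity) h.le
    positivity

theorem splits_genPoly (n : ℕ) : (genPoly n).Splits := by
  refine Splits.of_splits_map (algebraMap ℝ ℂ) (IsAlgClosed.splits _) fun z hz => ?_
  have h0 : aeval z (genPoly n) = 0 := by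
    have := (mem_roots'.1 hz).2
    rwa [IsRoot.def, eval_map_algebraMap] at this
  have him : z.im = 0 := by
    rcases lt_trichotomy z.im 0 with h | h | h
    · have h1 : 0 < (starRingEnd ℂ z).im := by simpa using h
      refine absurd ?_ (eval_genPoly_ne_zero h1 n).1
      rw [aeval_conj, h0, map_zero]
    · exact h
    · exact absurd h0 (eval_genPoly_ne_zero h n).1
  exact ⟨z.re, Complex.ext (by simp) (by simp [him])⟩

theorem roots_genPoly_nonpos {n : ℕ} {a : ℝ} (ha : a ∈ (genPoly n).roots) : a ≤ 0 := by
  by_contra! h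
  have h0 : (genPoly n).eval a = 0 := (mem_roots'.1 ha).2
  have hmin : ∀ k ∈ (genPoly n).support, (genPoly n).coeff k * a ^ k = 0 := by
    rw [eval_eq_sum, Polynomial.sum] at h0
    refine (sum_eq_zero_iff_of_nonneg fun k _ => ?_).1 h0
    rw [coeff_genPoly]
    exact mul_nonneg (p_nonneg n k) (pow_nonneg h.le k)
  have hz : genPoly n = 0 := by
    ext k
    by_contra hk
    have := hmin k (mem_support_iff.2 hk)
    exact hk ((mul_eq_zero.1 this).resolve_right (pow_ne_zero _ h.ne'))
  have := eval_one_genPoly n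
  rw [hz, eval_zero] at this
  norm_num at this

theorem momentMap_bernoulli_prod (l : List ℝ) (f : ℕ → ℝ) :
    momentMap f (l.map fun q => C (1 - q) + C q * X).prod = bernExp l f := by
  induction l generalizing f with
  | nil => simp [momentMap_one, bernExp]
  | cons q l ih =>
    rw [List.map_cons, List.prod_cons, add_mul, map_add, momentMap_C_mul, mul_assoc,
      momentMap_C_mul, momentMap_X_mul, ih, ih, bernExp]

/-- The distribution `p n` is that of a sum of independent Bernoulli variables. -/
theorem exists_bernExp_eq (n : ℕ) : ∃ l : List ℝ, (∀ q ∈ l, 0 ≤ q ∧ q ≤ 1) ∧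
    ∀ f, momentMap f (genPoly n) = bernExp l f := by
  set r := (genPoly n).roots.toList with hr
  have hr0 : ∀ a ∈ r, a ≤ 0 := fun a ha => roots_genPoly_nonpos (Multiset.mem_toList.1 ha)
  have hprod : ∀ r : List ℝ, (∀ a ∈ r, a ≤ 0) → ∃ κ : ℝ,
      (r.map fun a => X - C a).prod =
        C κ * ((r.map fun a => 1 / (1 - a)).map fun q => C (1 - q) + C q * X).prod := by
    intro r hr
    induction r with
    | nil => exact ⟨1, by simp⟩
    | cons a r ih =>
      obtain ⟨κ, hκ⟩ := ih fun b hb => hr b (by simp [hb])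
      have ha : 1 - a ≠ 0 := by
        have := hr a (by simp)
        exact (by linarith : 0 < 1 - a).ne'
      refine ⟨(1 - a) * κ, ?_⟩
      have hfac : X - C a = C (1 - a) * (C (1 - 1 / (1 - a)) + C (1 / (1 - a)) * X) := by
        rw [mul_add, ← mul_assoc, ← C_mul, ← C_mul, mul_one_div_cancel ha, mul_sub,
          mul_one_div_cancel ha]
        simp
        ring
      simp only [List.map_cons, List.prod_cons]
      rw [hκ, hfac, C_mul]
      ring
  obtain ⟨κ, hκ⟩ := hprod r hr0
  have hG : genPoly n = C ((genPoly n).leadingCoeff * κ) *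
      ((r.map fun a => 1 / (1 - a)).map fun q => C (1 - q) + C q * X).prod := by
    rw [C_mul, mul_assoc, ← hκ]
    conv_lhs => rw [(splits_genPoly n).eq_prod_roots]
    congr 1
    rw [← Multiset.prod_coe, ← Multiset.map_coe, hr, Multiset.coe_toList]
  have hmom : ∀ f, momentMap f (genPoly n) = (genPoly n).leadingCoeff * κ *
      bernExp (r.map fun a => 1 / (1 - a)) f := by
    intro f
    conv_lhs => rw [hG]
    rw [momentMap_C_mul, momentMap_bernoulli_prod]
  have h1 := hmom fun _ => 1
  rw [momentMap_one_genPoly, bernExp.const, mul_one] at h1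
  refine ⟨r.map fun a => 1 / (1 - a), fun q hq => ?_, fun f => by rw [hmom, ← h1, one_mul]⟩
  obtain ⟨a, ha, rfl⟩ := List.mem_map.1 hq
  have := hr0 a ha
  exact ⟨by rw [one_div]; exact inv_nonneg.2 (by linarith),
    (div_le_one (by linarith)).2 (by linarith)⟩

/-- Mean, variance and tail of `p n` in terms of a Bernoulli sum, with a logarithmic lower bound
on the variance. -/
theorem exists_bernoulli_representation {n : ℕ} (hn : 0 < n) :
    ∃ l : List ℝ, (∀ q ∈ l, 0 ≤ q ∧ q ≤ 1) ∧ μ n = l.sum ∧ σsq n = bernVar l ∧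
      (∀ t, tailProb n t = bernExp l fun k =>
        if l.sum + t * Real.sqrt (bernVar l) ≤ (k : ℝ) then 1 else 0) ∧
      10 / 27 * (Real.log n - 1) ≤ bernVar l := by
  obtain ⟨l, hl, hE⟩ := exists_bernExp_eq n
  have hsum : ∀ f : ℕ → ℝ, ∑ k ∈ Finset.Icc 1 n, f k * p n k = bernExp l f := fun f => by
    rw [← hE, momentMap_genPoly f hn]
  have hμ : μ n = l.sum := by rw [μ, hsum fun k => (k : ℝ), bernExp_mean]
  have hσ : σsq n = bernVar l := by
    rw [σsq, hμ, hsum fun k => ((k : ℝ) - l.sum) ^ 2, bernExp_sq_sub_mean]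
  refine ⟨l, hl, hμ, hσ, fun t => ?_, ?_⟩
  · rw [tailProb, hμ, hσ, ← hsum, sum_filter]
    exact sum_congr rfl fun k _ => by split_ifs <;> simp
  · obtain ⟨m, rfl⟩ := Nat.exists_eq_succ_of_ne_zero hn.ne'
    have h := log_le_factMomentOf m
    have hmean : meanOf (m + 1) = l.sum := by rw [meanOf, hE, bernExp_mean]
    have hfact : factMomentOf (m + 1) = bernVar l + l.sum ^ 2 - l.sum := by
      have e := bernExp_sq_sub_mean l
      have e2 : (fun k : ℕ => ((k : ℝ) - l.sum) ^ 2) = fun k : ℕ =>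
          (k : ℝ) * (k - 1) + ((1 - 2 * l.sum) * k + l.sum ^ 2) := by
        ext k; ring
      rw [e2, bernExp.add, bernExp.add, bernExp.const_mul, bernExp_mean, bernExp.const] at e
      rw [factMomentOf, hE]
      linarith
    rw [hmean, hfact] at h
    have hlog : Real.log ((m.succ : ℕ) : ℝ) ≤ Real.log (m + 2) :=
      Real.log_le_log (by positivity) (by push_cast; linarith)
    linarith

end GeneratingPolynomial

theorem log_le_σsq {n : ℕ} (hn : 0 < n) : 10 / 27 * (Real.log n - 1) ≤ σsq n := by
  obtain ⟨l, -, -, hσ, -, h⟩ := exists_bernoulli_representation hn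
  rwa [hσ]

theorem tailProb_estimate {n : ℕ} (hn : 0 < n) {t δ : ℝ} (ht : 0 ≤ t)
    (ht3 : (t + 4) ^ 3 ≤ Real.sqrt (σsq n))
    (hδ : (modDevConst + Real.exp 2) * (t + 4) ^ 3 / Real.sqrt (σsq n) = δ) (hδ1 : δ < 1) :
    (1 - δ) ^ 2 ≤ tailProb n t / gaussTail t ∧
      tailProb n t / gaussTail t ≤ (1 + δ) / (1 - δ) := by
  obtain ⟨l, hl, -, hσ, htail, -⟩ := exists_bernoulli_representation hn
  have hpos : 0 < Real.sqrt (bernVar l) := by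
    rw [← hσ]; exact lt_of_lt_of_le (by positivity) ht3
  rw [hσ] at ht3 hδ
  have h := bernExp_tail_estimate hl (Real.sq_sqrt (Real.sqrt_pos.1 hpos).le).symm ht ht3 hδ hδ1.le
  rw [← htail] at h
  have hQ := gaussTail_pos t
  rw [le_div_iff₀ hQ, div_le_div_iff₀ hQ (by linarith)]
  exact ⟨h.1, by linarith [h.2]⟩

theorem tendsto_cube_div_sqrt_σsq {t : ℕ → ℝ} (ht_nonneg : ∀ n, 0 ≤ t n)
    (ht : Filter.Tendsto (fun n : ℕ => t n / Real.log n ^ ((1 : ℝ) / 6)) Filter.atTop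
      (nhds 0)) :
    Filter.Tendsto (fun n => (t n + 4) ^ 3 / Real.sqrt (σsq n)) Filter.atTop (nhds 0) := by
  have hlog : Filter.Tendsto (fun n : ℕ => Real.log n) Filter.atTop Filter.atTop :=
    Real.tendsto_log_atTop.comp tendsto_natCast_atTop_atTop
  have hy : Filter.Tendsto (fun n : ℕ => Real.log n ^ ((1 : ℝ) / 6)) Filter.atTop Filter.atTop :=
    (tendsto_rpow_atTop (by norm_num)).comp hlog
  have h1 : Filter.Tendsto (fun n : ℕ => 3 * ((t n + 4) / Real.log n ^ ((1 : ℝ) / 6)) ^ 3)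
      Filter.atTop (nhds 0) := by
    have h2 := ((ht.add (hy.const_div_atTop 4)).pow 3).const_mul 3
    simpa [← add_div] using h2
  refine squeeze_zero' (Filter.Eventually.of_forall fun n => ?_) ?_ h1
  · have := ht_nonneg n
    positivity
  filter_upwards [hlog.eventually_ge_atTop 2, Filter.eventually_gt_atTop 0] with n hn hn0
  set y := Real.log n ^ ((1 : ℝ) / 6) with hy_def
  have hy0 : 0 < y := Real.rpow_pos_of_pos (by linarith) _
  have hy6 : y ^ 6 = Real.log n := by
    rw [hy_def, ← Real.rpow_natCast, ← Real.rpow_mul (by linarith)]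
    norm_num
  have hσ : y ^ 3 / 3 ≤ Real.sqrt (σsq n) := by
    refine Real.le_sqrt_of_sq_le ?_
    have := log_le_σsq hn0
    rw [div_pow, ← pow_mul, hy6]
    linarith
  have := ht_nonneg n
  calc (t n + 4) ^ 3 / Real.sqrt (σsq n) ≤ (t n + 4) ^ 3 / (y ^ 3 / 3) := by gcongr
    _ = 3 * ((t n + 4) / y) ^ 3 := by field_simp

open MeasureTheory in
/-- Normality zone of size `o((log n)^{1/6})`: for every sequence `(t_n)` of nonnegative
reals with `t_n/(log n)^{1/6} → 0`,
`P((f_0(T_n) − μ_n)/σ_n ≥ t_n) / ∫_{t_n}^∞ e^{−u²/2}/√(2π) du → 1` as `n → ∞`. -/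
theorem normality_zone (t : ℕ → ℝ) (ht_nonneg : ∀ n, 0 ≤ t n)
    (ht : Filter.Tendsto (fun n : ℕ => t n / Real.log n ^ ((1 : ℝ) / 6)) Filter.atTop
      (nhds 0)) :
    Filter.Tendsto
      (fun n : ℕ =>
        tailProb n (t n) /
          ∫ u in Set.Ioi (t n), Real.exp (-u ^ 2 / 2) / Real.sqrt (2 * Real.pi))
      Filter.atTop (nhds 1) := by
  have hx := tendsto_cube_div_sqrt_σsq ht_nonneg ht
  have hδ : Filter.Tendsto
      (fun n => (modDevConst + Real.exp 2) * (t n + 4) ^ 3 / Real.sqrt (σsq n))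
      Filter.atTop (nhds 0) := by
    simpa [mul_div_assoc] using hx.const_mul (modDevConst + Real.exp 2)
  have hlow := (hδ.const_sub 1).pow 2
  have hupp := (hδ.const_add 1).div (hδ.const_sub 1) (by norm_num)
  simp only [sub_zero, add_zero, one_pow, div_one] at hlow hupp
  have hev : ∀ᶠ n in Filter.atTop, 0 < n ∧ (t n + 4) ^ 3 ≤ Real.sqrt (σsq n) ∧
      (modDevConst + Real.exp 2) * (t n + 4) ^ 3 / Real.sqrt (σsq n) < 1 := by
    filter_upwards [Filter.eventually_ge_atTop 4, hx.eventually_lt_const one_pos,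
      hδ.eventually_lt_const one_pos] with n hn h1 h2
    have hlog : 1 < Real.log n := by
      rw [Real.lt_log_iff_exp_lt (by positivity)]
      have : (4 : ℝ) ≤ n := by exact_mod_cast hn
      linarith [Real.exp_one_lt_d9]
    have hσ : 0 < Real.sqrt (σsq n) :=
      Real.sqrt_pos.2 (by linarith [log_le_σsq (show 0 < n by omega)])
    exact ⟨by omega, ((div_lt_one hσ).1 h1).le, h2⟩
  refine tendsto_of_tendsto_of_tendsto_of_le_of_le' hlow hupp ?_ ?_
  · filter_upwards [hev] with n hn
    exact (tailProb_estimate hn.1 (ht_nonneg n) hn.2.1 rfl hn.2.2).1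
  · filter_upwards [hev] with n hn
    exact (tailProb_estimate hn.1 (ht_nonneg n) hn.2.1 rfl hn.2.2).2
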